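/- Let $0<\beta<d$, $f\in W^{1,1}_{\mathrm{pol}}(\mathbb{S}^d)$ and $\{f_j\}_{j\in\mathbb{N}}\subset W^{1,1}_{\mathrm{pol}}(\mathbb{S}^d)$ with $\|f_j-f\|_{W^{1,1}(\mathbb{S}^d)}\to 0$. Then $\lim_{j\to\infty}\widetilde{\mathcal{M}}_\beta f_j(\xi)=\widetilde{\mathcal{M}}_\beta f(\xi)$ for almost every $\xi\in\mathbb{S}^d$. -/

import Mathlib

open MeasureTheory Metric Filter Topology Asymptotics
open scoped ENNReal RealInnerProductSpace NNReal

noncomputable section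

/-- Euclidean space `ℝⁿ`. -/
abbrev Euc (n : ℕ) : Type := EuclideanSpace ℝ (Fin n)

/-- The unit sphere `𝕊^d ⊆ ℝ^(d+1)`. -/
abbrev Sph (d : ℕ) : Type := Metric.sphere (0 : Euc (d + 1)) 1

/-- The north pole `𝐞 = (1,0,…,0)`. -/
def npole (d : ℕ) : Sph d :=
  ⟨EuclideanSpace.single 0 1, by
    rw [mem_sphere_zero_iff_norm, EuclideanSpace.norm_single]; norm_num⟩

/-- The south pole `-𝐞`. -/
def spole (d : ℕ) : Sph d :=
  ⟨-(npole d : Euc (d + 1)), by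
    rw [mem_sphere_zero_iff_norm, norm_neg, ← mem_sphere_zero_iff_norm]
    exact (npole d).2⟩

/-- Geodesic distance on the sphere. -/
def geodist {d : ℕ} (ξ η : Sph d) : ℝ :=
  Real.arccos ⟪(ξ : Euc (d + 1)), (η : Euc (d + 1))⟫

/-- Open geodesic ball. -/
def gball {d : ℕ} (ζ : Sph d) (r : ℝ) : Set (Sph d) := {η | geodist ζ η < r}

/-- Closed geodesic ball. -/
def gcball {d : ℕ} (ζ : Sph d) (r : ℝ) : Set (Sph d) := {η | geodist ζ η ≤ r}

/-- Geodesic sphere (boundary of a geodesic ball). -/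
def gsphere {d : ℕ} (ζ : Sph d) (r : ℝ) : Set (Sph d) := {η | geodist ζ η = r}

/-- The surface measure `σ` on `𝕊^d`, as the `d`-dimensional Hausdorff measure. -/
def sphMeasure (d : ℕ) : Measure (Sph d) :=
  Measure.comap Subtype.val (MeasureTheory.Measure.hausdorffMeasure (d : ℝ))

/-- The `(d-1)`-dimensional Hausdorff measure on `𝕊^d` (surface measure of boundaries of
geodesic balls). -/
def sphBdry (d : ℕ) : Measure (Sph d) :=
  Measure.comap Subtype.val (MeasureTheory.Measure.hausdorffMeasure ((d : ℝ) - 1))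

/-- Polar angle `θ(ξ) = d(𝐞, ξ)`. -/
def polarAngle {d : ℕ} (ξ : Sph d) : ℝ := geodist (npole d) ξ

/-- `w(ξ) = min{θ(ξ), π - θ(ξ)}`. -/
def sphWidth {d : ℕ} (ξ : Sph d) : ℝ := min (polarAngle ξ) (Real.pi - polarAngle ξ)

/-- A function on the sphere is polar if it only depends on `ξ ⬝ 𝐞`. -/
def IsPolar {d : ℕ} (f : Sph d → ℝ) : Prop :=
  ∀ ξ η : Sph d,
    ⟪(ξ : Euc (d + 1)), (npole d : Euc (d + 1))⟫ =
      ⟪(η : Euc (d + 1)), (npole d : Euc (d + 1))⟫ → f ξ = f η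

/-- The uncentered fractional Hardy–Littlewood maximal function `𝓜̃_β f` on `𝕊^d`. -/
def sphMax {d : ℕ} (β : ℝ) (f : Sph d → ℝ) (ξ : Sph d) : ℝ :=
  sSup {a | ∃ ζ : Sph d, ∃ r : ℝ, 0 < r ∧ r ≤ Real.pi ∧ geodist ζ ξ ≤ r ∧
    a = r ^ β * ⨍ η in gball ζ r, |f η| ∂(sphMeasure d)}

/-- The closed ball `B̄(ζ,r)` is a best ball for `𝓜̃_β f` at `ξ`, i.e. it contains `ξ` and
realizes the supremum defining `𝓜̃_β f (ξ)`. -/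
def IsBestBall {d : ℕ} (β : ℝ) (f : Sph d → ℝ) (ξ ζ : Sph d) (r : ℝ) : Prop :=
  0 ≤ r ∧ r ≤ Real.pi ∧ geodist ζ ξ ≤ r ∧
    sphMax β f ξ = r ^ β * ⨍ η in gball ζ r, |f η| ∂(sphMeasure d)

/-- Projection onto the tangent space of the sphere at `η`. -/
def tangProj {d : ℕ} (η : Sph d) (v : Euc (d + 1)) : Euc (d + 1) :=
  v - ⟪v, (η : Euc (d + 1))⟫ • (η : Euc (d + 1))

/-- `g` is the weak (tangential) gradient of `f` on `𝕊^d`: `g` is a.e. tangent and the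
integration-by-parts formula against restrictions of smooth test functions holds. -/
def HasWeakGrad {d : ℕ} (f : Sph d → ℝ) (g : Sph d → Euc (d + 1)) : Prop :=
  (∀ᵐ η ∂(sphMeasure d), ⟪g η, (η : Euc (d + 1))⟫ = 0) ∧
  ∀ φ : Euc (d + 1) → ℝ, ContDiff ℝ (⊤ : ℕ∞) φ →
    ∫ η, φ (η : Euc (d + 1)) • g η ∂(sphMeasure d)
      = - ∫ η, f η • tangProj η (gradient φ (η : Euc (d + 1))) ∂(sphMeasure d)
        + (d : ℝ) • ∫ η, (f η * φ (η : Euc (d + 1))) • (η : Euc (d + 1)) ∂(sphMeasure d)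

/-- `f ∈ W^{1,1}(𝕊^d)`, with weak gradient `g`. -/
def MemW11 {d : ℕ} (f : Sph d → ℝ) (g : Sph d → Euc (d + 1)) : Prop :=
  Integrable f (sphMeasure d) ∧ Integrable g (sphMeasure d) ∧ HasWeakGrad f g

/-- Convergence `f_j → f` in `W^{1,1}(𝕊^d)` (with weak gradients `g_j, g`). -/
def W11Tendsto {d : ℕ} (fj : ℕ → Sph d → ℝ) (gj : ℕ → Sph d → Euc (d + 1))
    (f : Sph d → ℝ) (g : Sph d → Euc (d + 1)) : Prop :=
  Tendsto (fun j => (∫ ξ, |fj j ξ - f ξ| ∂(sphMeasure d)) +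
    ∫ ξ, ‖gj j ξ - g ξ‖ ∂(sphMeasure d)) atTop (nhds 0)

/-- `u : 𝕊^d → ℝ` is differentiable at `ξ` with (tangential) gradient `G`. -/
def HasSphereGradAt {d : ℕ} (u : Sph d → ℝ) (G : Euc (d + 1)) (ξ : Sph d) : Prop :=
  ⟪G, (ξ : Euc (d + 1))⟫ = 0 ∧
    (fun η : Sph d => u η - u ξ - ⟪G, (η : Euc (d + 1)) - (ξ : Euc (d + 1))⟫)
      =o[nhds ξ] (fun η : Sph d => dist η ξ)

/-- The unit tangent vector at `η` pointing in the direction of the geodesic from `η` to `ζ`: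
`v(η,ζ) = (ζ - (η·ζ)η)/|ζ - (η·ζ)η|`. -/
def gdir {d : ℕ} (η ζ : Sph d) : Euc (d + 1) :=
  ‖(ζ : Euc (d + 1)) - ⟪(η : Euc (d + 1)), (ζ : Euc (d + 1))⟫ • (η : Euc (d + 1))‖⁻¹ •
    ((ζ : Euc (d + 1)) - ⟪(η : Euc (d + 1)), (ζ : Euc (d + 1))⟫ • (η : Euc (d + 1)))

/-- `S(η) = (η·v(ξ,𝐞))ξ - (η·ξ)v(ξ,𝐞)`. -/
def Svec {d : ℕ} (ξ η : Sph d) : Euc (d + 1) :=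
  ⟪(η : Euc (d + 1)), gdir ξ (npole d)⟫ • (ξ : Euc (d + 1)) -
    ⟪(η : Euc (d + 1)), (ξ : Euc (d + 1))⟫ • gdir ξ (npole d)

/-- `ζ` lies on the (closed) half great circle determined by `𝐞`, `ξ` and `-𝐞`
(the one passing through `ξ`). -/
def OnHalfGreatCircle {d : ℕ} (ξ ζ : Sph d) : Prop :=
  ∃ a b : ℝ, 0 ≤ b ∧ (ζ : Euc (d + 1)) = a • (npole d : Euc (d + 1)) +
    b • ((ξ : Euc (d + 1)) -
      ⟪(ξ : Euc (d + 1)), (npole d : Euc (d + 1))⟫ • (npole d : Euc (d + 1)))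

/-- `σ(r)` up to the constant `κ_{d-1}`: `∫₀^r (sin t)^{d-1} dt`. -/
def sinInt (d : ℕ) (r : ℝ) : ℝ := ∫ t in (0:ℝ)..r, (Real.sin t) ^ (d - 1)

/-- `σ'(r)` up to the constant `κ_{d-1}`: `(sin r)^{d-1}`. -/
def sinPow (d : ℕ) (r : ℝ) : ℝ := (Real.sin r) ^ (d - 1)

/-- Height function. -/
def ht {d : ℕ} (ξ : Sph d) : ℝ := (ξ : Euc (d + 1)) 0

lemma inner_npole {d : ℕ} (ξ : Sph d) : ⟪(ξ : Euc (d + 1)), (npole d : Euc (d + 1))⟫ = ht ξ := by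
  simp [npole, ht, EuclideanSpace.inner_single_right]

lemma continuous_ht {d : ℕ} : Continuous (ht : Sph d → ℝ) := by
  unfold ht
  exact (EuclideanSpace.proj (𝕜 := ℝ) (0 : Fin (d+1))).continuous.comp continuous_subtype_val

lemma abs_ht_sub_le {d : ℕ} (ξ η : Sph d) : |ht ξ - ht η| ≤ ‖(ξ : Euc (d + 1)) - (η : Euc (d + 1))‖ := by
  have := PiLp.norm_apply_le ((ξ : Euc (d + 1)) - (η : Euc (d + 1))) 0
  simpa [ht] using this

lemma abs_ht_le {d : ℕ} (ξ : Sph d) : |ht ξ| ≤ 1 := by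
  have := PiLp.norm_apply_le ((ξ : Euc (d + 1))) 0
  have h2 : ‖(ξ : Euc (d + 1))‖ = 1 := by simp
  rw [h2] at this
  simpa [ht] using this

lemma sphMeasure_eq (d : ℕ) : sphMeasure d = Measure.hausdorffMeasure (X := Sph d) (d : ℝ) := by
  ext s hs
  rw [sphMeasure, (MeasurableEmbedding.subtype_coe
      (isClosed_sphere (x := (0 : Euc (d+1))) (ε := 1)).measurableSet).comap_apply]
  exact isometry_subtype_coe.hausdorffMeasure_image (Or.inl (by positivity)) s

lemma integrable_smul_cont {d : ℕ} {E : Type*} [NormedAddCommGroup E] [NormedSpace ℝ E]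
    {f : Sph d → E} (hf : Integrable f (sphMeasure d)) {c : Sph d → ℝ} (hc : Continuous c) :
    Integrable (fun η => c η • f η) (sphMeasure d) := by
  obtain ⟨C, hC⟩ := isCompact_univ.exists_bound_of_continuousOn hc.continuousOn
  exact hf.bdd_smul C hc.aestronglyMeasurable (Eventually.of_forall fun x => hC x trivial)

lemma integrable_mul_cont {d : ℕ}
    {f : Sph d → ℝ} (hf : Integrable f (sphMeasure d)) {c : Sph d → ℝ} (hc : Continuous c) :
    Integrable (fun η => c η * f η) (sphMeasure d) := integrable_smul_cont hf hc

lemma integrable_smul_cont' {d : ℕ} {E : Type*} [NormedAddCommGroup E] [NormedSpace ℝ E]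
    [SecondCountableTopology E]
    {f : Sph d → ℝ} (hf : Integrable f (sphMeasure d)) {c : Sph d → E} (hc : Continuous c) :
    Integrable (fun η => f η • c η) (sphMeasure d) := by
  obtain ⟨C, hC⟩ := isCompact_univ.exists_bound_of_continuousOn hc.continuousOn
  exact hf.smul_bdd C hc.aestronglyMeasurable (Eventually.of_forall fun x => hC x trivial)

/-- Scalar integration by parts identity. -/
def WId {d : ℕ} (h k : Sph d → ℝ) : Prop :=
  Integrable h (sphMeasure d) ∧ Integrable k (sphMeasure d) ∧
  ∀ ψ : ℝ → ℝ, ContDiff ℝ (⊤ : ℕ∞) ψ →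
    ∫ η, ψ (ht η) * k η ∂(sphMeasure d) =
      - ∫ η, (deriv ψ (ht η) * (1 - ht η ^ 2)) * h η ∂(sphMeasure d)
      + d * ∫ η, (ψ (ht η) * ht η) * h η ∂(sphMeasure d)

lemma WId.sub {d : ℕ} {h k h' k' : Sph d → ℝ} (H : WId h k) (H' : WId h' k') :
    WId (fun η => h η - h' η) (fun η => k η - k' η) := by
  obtain ⟨h1, h2, h3⟩ := H
  obtain ⟨h1', h2', h3'⟩ := H'
  refine ⟨h1.sub h1', h2.sub h2', fun ψ hψ => ?_⟩
  have c0 : Continuous (fun η : Sph d => ψ (ht η)) := hψ.continuous.comp continuous_ht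
  have c1 : Continuous (fun η : Sph d => deriv ψ (ht η) * (1 - ht η ^ 2)) :=
    ((hψ.continuous_deriv (by simp)).comp continuous_ht).mul
      (continuous_const.sub (continuous_ht.pow 2))
  have c2 : Continuous (fun η : Sph d => ψ (ht η) * ht η) := c0.mul continuous_ht
  simp only [mul_sub _ (h _) (h' _), mul_sub _ (k _) (k' _)]
  rw [integral_sub (integrable_mul_cont h2 c0) (integrable_mul_cont h2' c0),
    integral_sub (integrable_mul_cont h1 c1) (integrable_mul_cont h1' c1),
    integral_sub (integrable_mul_cont h1 c2) (integrable_mul_cont h1' c2)]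
  rw [h3 ψ hψ, h3' ψ hψ]
  ring

lemma WId.neg {d : ℕ} {h k : Sph d → ℝ} (H : WId h k) : WId (fun η => - h η) (fun η => - k η) := by
  have h0 : WId (d := d) (fun _ => 0) (fun _ => 0) :=
    ⟨integrable_zero _ _ _, integrable_zero _ _ _, fun ψ _ => by simp⟩
  simpa using h0.sub H

lemma gradient_ht {d : ℕ} {ψ : ℝ → ℝ} (hψ : Differentiable ℝ ψ) (x : Euc (d+1)) :
    gradient (fun y : Euc (d+1) => ψ (y 0)) x = deriv ψ (x 0) • EuclideanSpace.single 0 (1:ℝ) := by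
  apply HasGradientAt.gradient
  rw [hasGradientAt_iff_hasFDerivAt]
  have h1 := (hψ (x 0)).hasDerivAt.comp_hasFDerivAt x
    (EuclideanSpace.proj (𝕜 := ℝ) (0 : Fin (d+1))).hasFDerivAt
  refine h1.congr_fderiv ?_
  ext i
  simp [EuclideanSpace.inner_single_left]

lemma MemW11.wid {d : ℕ} {f : Sph d → ℝ} {g : Sph d → Euc (d+1)} (H : MemW11 f g) :
    WId f (fun η => g η 0) := by
  obtain ⟨h1, h2, -, h3⟩ := H
  let P := EuclideanSpace.proj (𝕜 := ℝ) (0 : Fin (d+1))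
  refine ⟨h1, P.integrable_comp h2, fun ψ hψ => ?_⟩
  have h4 := h3 (fun y => ψ (y 0)) (hψ.comp P.contDiff)
  have hdiff : Differentiable ℝ ψ := hψ.differentiable (by simp)
  simp only [gradient_ht hdiff, tangProj] at h4
  have c0 : Continuous (fun η : Sph d => ψ (ht η)) := hψ.continuous.comp continuous_ht
  have c1 : Continuous (fun η : Sph d => deriv ψ (ht η)) :=
    ((hψ.continuous_deriv (by simp)).comp continuous_ht)
  have h5 := congrArg P h4
  rw [map_add, map_neg, map_smul, ← P.integral_comp_comm, ← P.integral_comp_comm,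
    ← P.integral_comp_comm] at h5
  · have e1 : ∀ η : Sph d, P (f η • (deriv ψ ((η : Euc (d+1)) 0) • EuclideanSpace.single 0 (1:ℝ) -
        ⟪deriv ψ ((η : Euc (d+1)) 0) • EuclideanSpace.single 0 (1:ℝ), (η : Euc (d+1))⟫ •
          (η : Euc (d+1)))) = deriv ψ (ht η) * (1 - ht η ^ 2) * f η := by
      intro η
      simp [P, ht, EuclideanSpace.inner_single_left, inner_smul_left]
      ring
    have e2 : ∀ η : Sph d, P ((f η * ψ ((η : Euc (d+1)) 0)) • (η : Euc (d+1)))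
        = ψ (ht η) * ht η * f η := by
      intro η
      simp [P, ht]
      ring
    simp only [e1, e2, smul_eq_mul] at h5
    exact h5
  · have := integrable_smul_cont' h1 (c := fun η : Sph d => ψ (ht η) • (η : Euc (d+1)))
      (c0.smul continuous_subtype_val)
    refine this.congr (Eventually.of_forall fun η => ?_)
    simp [ht, smul_smul]
  · apply integrable_smul_cont' h1
    apply Continuous.sub
    · exact c1.smul continuous_const
    · have c3 : Continuous (fun η : Sph d => deriv ψ (ht η) • EuclideanSpace.single (0 : Fin (d+1)) (1:ℝ)) :=
        c1.smul continuous_const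
      have c4 : Continuous (fun η : Sph d =>
          ⟪deriv ψ (ht η) • EuclideanSpace.single (0 : Fin (d+1)) (1:ℝ), (η : Euc (d+1))⟫) :=
        c3.inner continuous_subtype_val
      exact c4.smul continuous_subtype_val
  · exact integrable_smul_cont h2 c0

/-- The (scalar) Sobolev norm. -/
def NN {d : ℕ} (h k : Sph d → ℝ) : ℝ :=
  (∫ η, |k η| ∂(sphMeasure d)) + d * ∫ η, |h η| ∂(sphMeasure d)

lemma NN_nonneg {d : ℕ} (h k : Sph d → ℝ) : 0 ≤ NN h k := by
  unfold NN
  have := integral_nonneg (μ := sphMeasure d) (f := fun η => |h η|) (fun _ => abs_nonneg _)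
  have := integral_nonneg (μ := sphMeasure d) (f := fun η => |k η|) (fun _ => abs_nonneg _)
  positivity

lemma abs_int_le {d : ℕ} {f c : Sph d → ℝ} (hf : Integrable f (sphMeasure d)) {C : ℝ}
    (hc : ∀ η, |c η| ≤ C) : |∫ η, c η * f η ∂(sphMeasure d)| ≤ C * ∫ η, |f η| ∂(sphMeasure d) := by
  rw [← integral_const_mul, ← Real.norm_eq_abs]
  apply norm_integral_le_of_norm_le (hf.abs.const_mul C)
  refine Eventually.of_forall fun η => ?_
  rw [Real.norm_eq_abs, abs_mul]
  exact mul_le_mul_of_nonneg_right (hc η) (abs_nonneg _)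

lemma WId.smooth_bound {d : ℕ} {h k : Sph d → ℝ} (H : WId h k) {v : ℝ → ℝ}
    (hv : ContDiff ℝ (⊤ : ℕ∞) v) :
    |∫ η, (v (ht η) * (1 - ht η ^ 2)) * h η ∂(sphMeasure d)| ≤
      NN h k * ∫ s in Set.Icc (-1:ℝ) 1, |v s| := by
  obtain ⟨h1, h2, h3⟩ := H
  set ψ : ℝ → ℝ := fun x => ∫ s in (-1:ℝ)..x, v s with hψ
  have hd : ∀ x, HasDerivAt ψ (v x) x := fun x =>
    intervalIntegral.integral_hasDerivAt_right (hv.continuous.intervalIntegrable _ _)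
      hv.continuous.stronglyMeasurable.stronglyMeasurableAtFilter hv.continuous.continuousAt
  have hderiv : deriv ψ = v := funext fun x => (hd x).deriv
  have hs : ContDiff ℝ (⊤ : ℕ∞) ψ := by
    rw [contDiff_infty_iff_deriv, hderiv]
    exact ⟨fun x => (hd x).differentiableAt, hv⟩
  have h4 := h3 ψ hs
  rw [hderiv] at h4
  set V := ∫ s in Set.Icc (-1:ℝ) 1, |v s| with hV
  have hb : ∀ η : Sph d, |ψ (ht η)| ≤ V := by
    intro η
    have h5 := abs_le.1 (abs_ht_le η)
    rw [hψ, hV]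
    refine (intervalIntegral.abs_integral_le_integral_abs h5.1).trans ?_
    rw [intervalIntegral.integral_of_le h5.1]
    apply setIntegral_mono_set
    · exact hv.continuous.abs.integrableOn_Icc
    · exact Eventually.of_forall fun _ => abs_nonneg _
    · exact (Set.Ioc_subset_Icc_self.trans (Set.Icc_subset_Icc le_rfl h5.2)).eventuallyLE
  have hb2 : ∀ η : Sph d, |ψ (ht η) * ht η| ≤ V := by
    intro η
    rw [abs_mul]
    calc _ ≤ |ψ (ht η)| * 1 := mul_le_mul_of_nonneg_left (abs_ht_le η) (abs_nonneg _)
      _ ≤ V := by rw [mul_one]; exact hb η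
  have b1 := abs_int_le h2 hb
  have b2 := abs_int_le h1 hb2
  have : ∫ η, (v (ht η) * (1 - ht η ^ 2)) * h η ∂(sphMeasure d) =
    d * ∫ η, (ψ (ht η) * ht η) * h η ∂(sphMeasure d) - ∫ η, ψ (ht η) * k η ∂(sphMeasure d) := by
      linarith
  rw [this]
  refine (abs_sub _ _).trans ?_
  rw [abs_mul, Nat.abs_cast, NN]
  have := mul_le_mul_of_nonneg_left b2 (Nat.cast_nonneg (α := ℝ) d)
  linarith

lemma WId.meas_bound {d : ℕ} {h k : Sph d → ℝ} (H : WId h k) {A : Set ℝ} (hA : MeasurableSet A) :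
    |∫ η in ht ⁻¹' A, (1 - ht η ^ 2) * h η ∂(sphMeasure d)| ≤
      NN h k * (volume.restrict (Set.Icc (-1:ℝ) 1)).real A := by
  set q : Sph d → ℝ := fun η => (1 - ht η ^ 2) * h η with hq
  have hqi : Integrable q (sphMeasure d) :=
    integrable_mul_cont H.1 (continuous_const.sub (continuous_ht.pow 2))
  set τ : Measure (Sph d) := (sphMeasure d).withDensity (fun η => ‖q η‖ₑ) with hτ
  have : IsFiniteMeasure τ := isFiniteMeasure_withDensity hqi.2.ne
  set ρ0 : Measure ℝ := volume.restrict (Set.Icc (-1:ℝ) 1) with hρ0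
  set ρ : Measure ℝ := ρ0 + τ.map ht with hρ
  have hfin0 : IsFiniteMeasure ρ0 := by rw [hρ0]; infer_instance
  have hfin : IsFiniteMeasure (τ.map ht) := Measure.isFiniteMeasure_map _ _
  have hN := NN_nonneg h k
  have key : ∀ ε > 0, |∫ η in ht ⁻¹' A, q η ∂(sphMeasure d)| ≤ NN h k * (ρ0.real A + ε) + ε := by
    intro ε hε
    have hm : MemLp (A.indicator (fun _ => (1:ℝ))) 1 ρ := memLp_indicator_const 1 hA 1
      (Or.inr (measure_ne_top _ _))
    obtain ⟨v, hvc, hvs, hv⟩ := hm.exist_eLpNorm_sub_le ENNReal.one_ne_top le_rfl hε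
    rw [eLpNorm_one_eq_lintegral_enorm, hρ, lintegral_add_measure] at hv
    set w : ℝ → ℝ := A.indicator (fun _ => (1:ℝ)) - v with hw
    have hwm : Measurable w := (measurable_const.indicator hA).sub hvs.continuous.measurable
    have hv1 : ∫⁻ x, ‖w x‖ₑ ∂ρ0 ≤ ENNReal.ofReal ε := le_self_add.trans hv
    have hv2 : ∫⁻ x, ‖w x‖ₑ ∂(τ.map ht) ≤ ENNReal.ofReal ε := le_add_self.trans hv
    have hI1 : Integrable (A.indicator (fun _ => (1:ℝ))) ρ0 :=
      (integrable_const (1:ℝ)).indicator hA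
    have hIv : Integrable v ρ0 := hvs.continuous.integrableOn_Icc
    have hw1 : ∫ x, |w x| ∂ρ0 ≤ ε := by
      have := integral_norm_eq_lintegral_enorm (μ := ρ0) (f := w) hwm.aestronglyMeasurable
      simp only [Real.norm_eq_abs] at this
      rw [this]
      exact ENNReal.toReal_le_of_le_ofReal hε.le hv1
    have hvbd : ∫ x, |v x| ∂ρ0 ≤ ρ0.real A + ε := by
      calc ∫ x, |v x| ∂ρ0 ≤ ∫ x, (A.indicator (fun _ => (1:ℝ)) x + |w x|) ∂ρ0 := by
            apply integral_mono hIv.abs (hI1.add (hI1.sub hIv).abs)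
            intro x
            have : v x = A.indicator (fun _ => (1:ℝ)) x - w x := by simp [hw]
            have h0 : 0 ≤ A.indicator (fun _ => (1:ℝ)) x :=
              Set.indicator_nonneg (fun _ _ => zero_le_one) x
            show |v x| ≤ A.indicator (fun _ => (1:ℝ)) x + |w x|
            rw [this]
            refine (abs_sub _ _).trans ?_
            rw [abs_of_nonneg h0]
        _ = ρ0.real A + ∫ x, |w x| ∂ρ0 := by
            rw [integral_add hI1 (hI1.sub hIv).abs, integral_indicator_const _ hA]
            simp [hw]
        _ ≤ _ := by linarith
    have hsm := H.smooth_bound hvs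
    have e1 : ∫ η in ht ⁻¹' A, q η ∂(sphMeasure d) =
        ∫ η, A.indicator (fun _ => (1:ℝ)) (ht η) * q η ∂(sphMeasure d) := by
      rw [← integral_indicator (continuous_ht.measurable hA)]
      congr 1
      ext η
      by_cases hη : ht η ∈ A <;> simp [Set.indicator, hη]
    have hqv : Integrable (fun η => v (ht η) * q η) (sphMeasure d) :=
      integrable_mul_cont hqi (hvs.continuous.comp continuous_ht)
    have hqA : Integrable (fun η => A.indicator (fun _ => (1:ℝ)) (ht η) * q η) (sphMeasure d) := by
      refine (hqi.indicator (continuous_ht.measurable hA)).congr (Eventually.of_forall fun η => ?_)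
      by_cases hη : ht η ∈ A <;> simp [Set.indicator, hη]
    have e2 : ∫ η, w (ht η) * q η ∂(sphMeasure d) =
        ∫ η in ht ⁻¹' A, q η ∂(sphMeasure d) - ∫ η, v (ht η) * q η ∂(sphMeasure d) := by
      rw [e1, ← integral_sub hqA hqv]
      congr 1
      ext η
      simp [hw, sub_mul]
    have e3 : |∫ η, w (ht η) * q η ∂(sphMeasure d)| ≤ ε := by
      rw [← Real.norm_eq_abs]
      refine (norm_integral_le_lintegral_norm _).trans ?_
      apply ENNReal.toReal_le_of_le_ofReal hε.le
      refine le_trans (le_of_eq ?_) hv2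
      rw [lintegral_map hwm.enorm continuous_ht.measurable, hτ]
      refine Eq.trans ?_ (lintegral_withDensity_eq_lintegral_mul₀ hqi.1.enorm
          (hwm.comp continuous_ht.measurable).enorm.aemeasurable).symm
      congr 1
      ext η
      rw [ofReal_norm, enorm_mul, mul_comm]; rfl
    have e4 : ∫ η, (v (ht η) * (1 - ht η ^ 2)) * h η ∂(sphMeasure d)
        = ∫ η, v (ht η) * q η ∂(sphMeasure d) := by
      congr 1
      ext η
      simp [hq]; ring
    rw [e4] at hsm
    have e5 : ∫ η in ht ⁻¹' A, q η ∂(sphMeasure d) =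
      ∫ η, w (ht η) * q η ∂(sphMeasure d) + ∫ η, v (ht η) * q η ∂(sphMeasure d) := by
        rw [e2]; ring
    rw [e5]
    refine (abs_add_le _ _).trans ?_
    have := mul_le_mul_of_nonneg_left hvbd hN
    linarith
  refine le_of_forall_pos_le_add fun ε hε => ?_
  have := key (ε / (NN h k + 1)) (by positivity)
  refine this.trans (le_of_eq ?_)
  field_simp
  ring

lemma lower_measure (d : ℕ) (hd : 1 ≤ d) (δ : ℝ) (hδ : 0 < δ) (hδ1 : δ < 1) :
    ∃ c : ℝ, 0 < c ∧ ∀ A ⊆ Set.Icc (-(1-δ)) (1-δ),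
      ENNReal.ofReal c * volume A ≤ sphMeasure d (ht ⁻¹' A) := by
  obtain ⟨n, rfl⟩ : ∃ n, d = n + 1 := ⟨d - 1, by omega⟩
  set s : ℝ := δ / (n + 1) with hs
  have hs0 : 0 < s := by positivity
  refine ⟨(2 * s) ^ n, by positivity, fun A hA => ?_⟩
  let Pi : Sph (n+1) → (Fin (n+1) → ℝ) := fun x i => (x : Euc (n+1+1)) i.castSucc
  have hL : LipschitzWith 1 Pi := by
    refine LipschitzWith.of_dist_le_mul fun x y => ?_
    rw [NNReal.coe_one, one_mul, dist_pi_le_iff dist_nonneg]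
    intro i
    have := PiLp.norm_apply_le ((x : Euc (n+1+1)) - (y : Euc (n+1+1))) i.castSucc
    rw [Subtype.dist_eq, dist_eq_norm, dist_eq_norm]
    simpa using this
  have h1 := hL.hausdorffMeasure_image_le (d := ((n+1 : ℕ) : ℝ)) (by positivity) (ht ⁻¹' A)
  rw [← sphMeasure_eq] at h1
  simp only [ENNReal.coe_one, ENNReal.one_rpow, one_mul] at h1
  refine le_trans ?_ h1
  have h2 : (Measure.hausdorffMeasure ((n+1 : ℕ) : ℝ) : Measure (Fin (n+1) → ℝ)) = volume := by
    have := hausdorffMeasure_pi_real (ι := Fin (n+1))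
    rwa [Fintype.card_fin] at this
  rw [h2]
  let S : Fin (n+1) → Set ℝ := Fin.cons A (fun _ => Set.Icc (-s) s)
  have h3 : volume (Set.pi Set.univ S) = ENNReal.ofReal ((2 * s) ^ n) * volume A := by
    rw [volume_pi_pi, Fin.prod_univ_succ]
    simp only [S, Fin.cons_zero, Fin.cons_succ, Real.volume_Icc, Finset.prod_const,
      Finset.card_univ, Fintype.card_fin]
    rw [mul_comm, ENNReal.ofReal_pow (by positivity)]
    congr 3
    ring
  rw [← h3]
  apply measure_mono
  intro y hy
  have hy0 : y 0 ∈ A := by simpa [S] using hy 0 trivial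
  have hyi : ∀ i : Fin n, y i.succ ∈ Set.Icc (-s) s := fun i => by
    simpa only [S, Fin.cons_succ] using hy i.succ trivial
  have hsum : ∑ i, y i ^ 2 ≤ 1 := by
    rw [Fin.sum_univ_succ]
    have b1 : y 0 ^ 2 ≤ (1 - δ) ^ 2 := sq_le_sq' (hA hy0).1 (hA hy0).2
    have b2 : ∑ i : Fin n, y i.succ ^ 2 ≤ ∑ i : Fin n, s ^ 2 :=
      Finset.sum_le_sum fun i _ => sq_le_sq' (hyi i).1 (hyi i).2
    simp only [Finset.sum_const, Finset.card_univ, Fintype.card_fin, nsmul_eq_mul] at b2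
    have b3 : (n : ℝ) * s ^ 2 ≤ δ := by
      have e : ((n : ℝ) + 1) * s = δ := by rw [hs]; field_simp
      have : s ≤ 1 := by
        have : (0:ℝ) ≤ n * s := by positivity
        nlinarith
      nlinarith
    nlinarith
  refine ⟨⟨WithLp.toLp 2 (Fin.snoc y (Real.sqrt (1 - ∑ i, y i ^ 2))), ?_⟩, ?_, ?_⟩
  · rw [mem_sphere_zero_iff_norm, EuclideanSpace.norm_eq, Real.sqrt_eq_one, Fin.sum_univ_castSucc]
    simp only [Fin.snoc_castSucc, Fin.snoc_last, Real.norm_eq_abs, sq_abs]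
    rw [Real.sq_sqrt (by linarith)]
    ring
  · show Fin.snoc (α := fun _ => ℝ) y (Real.sqrt (1 - ∑ i, y i ^ 2)) (Fin.castSucc 0) ∈ A
    rw [Fin.snoc_castSucc]
    exact hy0
  · ext i
    show Fin.snoc (α := fun _ => ℝ) y (Real.sqrt (1 - ∑ i, y i ^ 2)) (Fin.castSucc i) = _
    rw [Fin.snoc_castSucc]

lemma polar_set {d : ℕ} {h : Sph d → ℝ} (hp : IsPolar h) (hm : AEStronglyMeasurable h (sphMeasure d))
    (M : ℝ) : ∃ B : Set ℝ, MeasurableSet B ∧ ∀ᵐ η ∂(sphMeasure d), (M < h η ↔ ht η ∈ B) := by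
  have n1 : NullMeasurableSet {η | M < h η} (sphMeasure d) :=
    nullMeasurableSet_lt aemeasurable_const hm.aemeasurable
  obtain ⟨E, hE, hEm, hEe⟩ := n1.exists_measurable_subset_ae_eq
  obtain ⟨F, hF, hFm, hFe⟩ := n1.compl.exists_measurable_subset_ae_eq
  have : PolishSpace (Sph d) :=
    (isClosed_sphere (x := (0 : Euc (d+1))) (ε := 1)).polishSpace
  have a1 := hEm.analyticSet_image (continuous_ht (d := d)).measurable
  have a2 := hFm.analyticSet_image (continuous_ht (d := d)).measurable
  have hdis : Disjoint (ht '' E) (ht '' F) := by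
    rw [Set.disjoint_left]
    rintro _ ⟨x, hx, rfl⟩ ⟨y, hy, hxy⟩
    have e : h y = h x := hp y x (by rw [inner_npole, inner_npole, hxy])
    have h1 : M < h x := hE hx
    have h2 : ¬ M < h y := hF hy
    rw [e] at h2
    exact h2 h1
  obtain ⟨B, hB1, hB2, hB⟩ := a1.measurablySeparable a2 hdis
  refine ⟨B, hB, ?_⟩
  filter_upwards [hEe.mem_iff, hFe.mem_iff] with η h1 h2
  constructor
  · intro h3
    exact hB1 ⟨η, h1.2 h3, rfl⟩
  · intro h3
    by_contra h4
    exact Set.disjoint_left.1 hB2 ⟨η, h2.2 h4, rfl⟩ h3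

lemma WId.sup_bound {d : ℕ} {h k : Sph d → ℝ} (H : WId h k) (hp : IsPolar h)
    {δ : ℝ} (hδ : 0 < δ) (hδ1 : δ < 1) {c : ℝ} (hc : 0 < c)
    (hlow : ∀ A ⊆ Set.Icc (-(1-δ)) (1-δ),
      ENNReal.ofReal c * volume A ≤ sphMeasure d (ht ⁻¹' A)) {M : ℝ} (hM : NN h k / (c * δ) < M) :
    ∀ᵐ η ∂(sphMeasure d), |ht η| ≤ 1 - δ → h η ≤ M := by
  have hN := NN_nonneg h k
  have hM0 : 0 < M := lt_of_le_of_lt (by positivity) hM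
  obtain ⟨B, hB, hBe⟩ := polar_set hp H.1.1 M
  set A := B ∩ Set.Icc (-(1-δ)) (1-δ) with hA
  have hAm : MeasurableSet A := hB.inter measurableSet_Icc
  set T : Set (Sph d) := ht ⁻¹' A with hT
  have hTm : MeasurableSet T := continuous_ht.measurable hAm
  have hTfin : sphMeasure d T < ⊤ := by
    refine lt_of_le_of_lt ?_ (H.1.measure_gt_lt_top hM0)
    apply measure_mono_ae
    filter_upwards [hBe] with η h1 h2
    exact h1.2 h2.1
  have hge : ∀ x : ℝ, x ∈ Set.Icc (-(1-δ)) (1-δ) → δ ≤ 1 - x ^ 2 := by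
    intro x hx
    have : x ^ 2 ≤ (1 - δ) ^ 2 := sq_le_sq' hx.1 hx.2
    nlinarith
  have b1 : M * δ * (sphMeasure d).real T ≤ ∫ η in T, (1 - ht η ^ 2) * h η ∂(sphMeasure d) := by
    have : ∫ η in T, M * δ ∂(sphMeasure d) = M * δ * (sphMeasure d).real T := by
      rw [setIntegral_const, smul_eq_mul, mul_comm]
    rw [← this]
    apply setIntegral_mono_on_ae
    · exact integrableOn_const hTfin.ne
    · exact (integrable_mul_cont H.1
        (continuous_const.sub (continuous_ht.pow 2))).integrableOn
    · exact hTm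
    · filter_upwards [hBe] with η h1 h2
      have h3 := h1.2 h2.1
      have h4 := hge _ h2.2
      nlinarith
  have b2 := (le_abs_self _).trans (H.meas_bound hAm)
  have hAfin : volume A < ⊤ := lt_of_le_of_lt (measure_mono Set.inter_subset_right)
    measure_Icc_lt_top
  have b3 : (volume.restrict (Set.Icc (-1:ℝ) 1)).real A ≤ volume.real A := by
    apply ENNReal.toReal_mono hAfin.ne
    exact Measure.restrict_apply_le _ _
  have b4 : c * volume.real A ≤ (sphMeasure d).real T := by
    have := ENNReal.toReal_mono hTfin.ne (hlow A Set.inter_subset_right)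
    rwa [ENNReal.toReal_mul, ENNReal.toReal_ofReal hc.le] at this
  have b5 : (sphMeasure d).real T = 0 := by
    by_contra hne
    have hpos : 0 < (sphMeasure d).real T := lt_of_le_of_ne measureReal_nonneg (Ne.symm hne)
    rw [div_lt_iff₀ (by positivity)] at hM
    have c1 : M * δ * (sphMeasure d).real T ≤ NN h k * volume.real A :=
      b1.trans (b2.trans (mul_le_mul_of_nonneg_left b3 hN))
    have c2 : c * (M * δ * (sphMeasure d).real T) ≤ NN h k * (sphMeasure d).real T := by
      calc c * (M * δ * (sphMeasure d).real T) ≤ c * (NN h k * volume.real A) :=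
            mul_le_mul_of_nonneg_left c1 hc.le
        _ = NN h k * (c * volume.real A) := by ring
        _ ≤ _ := mul_le_mul_of_nonneg_left b4 hN
    have c3 := mul_lt_mul_of_pos_right hM hpos
    linarith
  have b6 : sphMeasure d T = 0 := by
    rcases (ENNReal.toReal_eq_zero_iff _).1 b5 with h | h
    · exact h
    · exact absurd h hTfin.ne
  filter_upwards [hBe, measure_eq_zero_iff_ae_notMem.1 b6] with η h1 h2 h3
  by_contra h4
  exact h2 ⟨h1.1 (not_le.1 h4), abs_le.1 h3⟩

lemma inner_bds {d : ℕ} (ξ η : Sph d) :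
    -1 ≤ ⟪(ξ : Euc (d + 1)), (η : Euc (d + 1))⟫ ∧ ⟪(ξ : Euc (d + 1)), (η : Euc (d + 1))⟫ ≤ 1 := by
  have := abs_real_inner_le_norm (ξ : Euc (d + 1)) (η : Euc (d + 1))
  have h1 : ‖(ξ : Euc (d + 1))‖ = 1 := by simp
  have h2 : ‖(η : Euc (d + 1))‖ = 1 := by simp
  rw [h1, h2, mul_one] at this
  exact abs_le.1 this

lemma chord_le {d : ℕ} (ξ η : Sph d) : ‖(ξ : Euc (d + 1)) - (η : Euc (d + 1))‖ ≤ geodist ξ η := by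
  have h1 : ‖(ξ : Euc (d + 1))‖ = 1 := by simp
  have h2 : ‖(η : Euc (d + 1))‖ = 1 := by simp
  have h0 : 0 ≤ geodist ξ η := Real.arccos_nonneg _
  apply le_of_sq_le_sq _ h0
  rw [norm_sub_sq_real, h1, h2]
  have h3 := Real.one_sub_sq_div_two_le_cos (x := geodist ξ η)
  have h4 : Real.cos (geodist ξ η) = ⟪(ξ : Euc (d + 1)), (η : Euc (d + 1))⟫ :=
    Real.cos_arccos (inner_bds ξ η).1 (inner_bds ξ η).2
  rw [h4] at h3
  linarith

lemma continuous_geodist {d : ℕ} (ζ : Sph d) : Continuous (fun η : Sph d => geodist ζ η) :=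
  Real.continuous_arccos.comp (continuous_const.inner continuous_subtype_val)

lemma measurable_gball {d : ℕ} (ζ : Sph d) (r : ℝ) : MeasurableSet (gball ζ r) :=
  (isOpen_lt (continuous_geodist ζ) continuous_const).measurableSet

lemma gball_inv {d : ℕ} (ζ ζ' : Sph d) (r : ℝ) :
    sphMeasure d (gball ζ r) ≤ sphMeasure d (gball ζ' r) := by
  have h1 : ‖(ζ : Euc (d + 1))‖ = 1 := by simp
  have h2 : ‖(ζ' : Euc (d + 1))‖ = 1 := by simp
  let R : Euc (d+1) ≃ₗᵢ[ℝ] Euc (d+1) :=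
    (Submodule.span ℝ {(ζ : Euc (d + 1)) - (ζ' : Euc (d + 1))})ᗮ.reflection
  have hR : R (ζ : Euc (d+1)) = ζ' := Submodule.reflection_sub (h1.trans h2.symm)
  let Q : Sph d → Sph d := fun x => ⟨R x, by
    rw [mem_sphere_zero_iff_norm, R.norm_map, ← mem_sphere_zero_iff_norm]; exact x.2⟩
  have hQ : Isometry Q := by
    refine Isometry.of_dist_eq fun x y => ?_
    rw [Subtype.dist_eq, Subtype.dist_eq]
    exact R.dist_map _ _
  rw [sphMeasure_eq, ← hQ.hausdorffMeasure_image (Or.inl (by positivity))]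
  apply measure_mono
  rintro _ ⟨x, hx, rfl⟩
  show geodist ζ' (Q x) < r
  have : geodist ζ' (Q x) = geodist ζ x := by
    unfold geodist
    show Real.arccos ⟪(ζ' : Euc (d+1)), R x⟫ = _
    rw [← hR, R.inner_map_map]
  rw [this]
  exact hx

lemma gball_lower (d : ℕ) (hd : 1 ≤ d) {ρ : ℝ} (hρ : 0 < ρ) :
    ∃ c : ℝ, 0 < c ∧ ∀ (ζ : Sph d) (r : ℝ), ρ ≤ r → ENNReal.ofReal c ≤ sphMeasure d (gball ζ r) := by
  set t := min ρ 1 with ht'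
  have t0 : 0 < t := lt_min hρ one_pos
  have t1 : t ≤ 1 := min_le_right _ _
  have pi3 := Real.pi_gt_three
  have hc1 : Real.cos t < Real.cos (t/2) :=
    Real.cos_lt_cos_of_nonneg_of_le_pi (by linarith) (by linarith) (by linarith)
  have hc2 : Real.cos (t/2) < 1 := by
    rw [← Real.cos_zero]
    exact Real.cos_lt_cos_of_nonneg_of_le_pi le_rfl (by linarith) (by linarith)
  have hc3 : 0 < Real.cos t := Real.cos_pos_of_mem_Ioo ⟨by linarith, by linarith⟩
  obtain ⟨c, hc, hlow⟩ := lower_measure d hd (1 - Real.cos (t/2)) (by linarith) (by linarith)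
  refine ⟨c * (Real.cos (t/2) - Real.cos t), mul_pos hc (by linarith), fun ζ r hr => ?_⟩
  have h1 := hlow (Set.Ioo (Real.cos t) (Real.cos (t/2))) (by
    intro x hx
    constructor <;> linarith [hx.1, hx.2])
  rw [Real.volume_Ioo, ← ENNReal.ofReal_mul hc.le] at h1
  refine h1.trans (le_trans (measure_mono ?_) (gball_inv (npole d) ζ r))
  intro η hη
  show geodist (npole d) η < r
  unfold geodist
  rw [real_inner_comm, inner_npole]
  have h2 : Real.arccos (ht η) < Real.arccos (Real.cos t) :=
    Real.arccos_lt_arccos (by linarith) hη.1 (abs_le.1 (abs_ht_le η)).2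
  rw [Real.arccos_cos t0.le (by linarith)] at h2
  have : t ≤ ρ := min_le_left _ _
  linarith

lemma avg_le {d : ℕ} {h : Sph d → ℝ} {s : Set (Sph d)} (hs : MeasurableSet s) {M : ℝ} (hM : 0 ≤ M)
    (hh : ∀ᵐ η ∂(sphMeasure d), η ∈ s → |h η| ≤ M) : ⨍ η in s, |h η| ∂(sphMeasure d) ≤ M := by
  rw [setAverage_eq, smul_eq_mul]
  by_cases hz : (sphMeasure d).real s = 0
  · rw [hz]; simpa using hM
  · have hfin : sphMeasure d s < ⊤ := by
      rw [lt_top_iff_ne_top]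
      intro h
      apply hz
      simp [Measure.real, h]
    have hpos : 0 < (sphMeasure d).real s := lt_of_le_of_ne measureReal_nonneg (Ne.symm hz)
    rw [inv_mul_le_iff₀ hpos]
    have := norm_setIntegral_le_of_norm_le_const_ae' (f := fun η => |h η|) (C := M) hfin (by
      filter_upwards [hh] with η h1 h2
      rw [Real.norm_eq_abs, abs_abs]
      exact h1 h2)
    have := (le_abs_self _).trans this
    linarith

lemma avg_le_int {d : ℕ} {h : Sph d → ℝ} (hi : Integrable h (sphMeasure d)) {s : Set (Sph d)}
    {c : ℝ} (hc : 0 < c) (hs : ENNReal.ofReal c ≤ sphMeasure d s) :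
    ⨍ η in s, |h η| ∂(sphMeasure d) ≤ c⁻¹ * ∫ η, |h η| ∂(sphMeasure d) := by
  have h0 : 0 ≤ ∫ η, |h η| ∂(sphMeasure d) := integral_nonneg fun _ => abs_nonneg _
  rw [setAverage_eq, smul_eq_mul]
  have h1 : ∫ η in s, |h η| ∂(sphMeasure d) ≤ ∫ η, |h η| ∂(sphMeasure d) :=
    setIntegral_le_integral hi.abs (Eventually.of_forall fun _ => abs_nonneg _)
  by_cases hfin : sphMeasure d s = ⊤
  · simp only [Measure.real, hfin, ENNReal.toReal_top, inv_zero, zero_mul]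
    positivity
  · have h2 : c ≤ (sphMeasure d).real s := (ENNReal.ofReal_le_iff_le_toReal hfin).1 hs
    have h3 : ((sphMeasure d).real s)⁻¹ ≤ c⁻¹ := inv_anti₀ hc h2
    exact (mul_le_mul_of_nonneg_left h1 (by positivity)).trans (mul_le_mul_of_nonneg_right h3 h0)

lemma elem_bound {d : ℕ} (hd : 1 ≤ d) {β : ℝ} (hβ : 0 < β) {ξ : Sph d} (hξ : |ht ξ| < 1) :
    ∃ C : ℝ, 0 ≤ C ∧ ∀ h k : Sph d → ℝ, WId h k → IsPolar h → ∀ (ζ : Sph d) (r : ℝ), 0 < r →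
      r ≤ Real.pi → geodist ζ ξ ≤ r →
      r ^ β * ⨍ η in gball ζ r, |h η| ∂(sphMeasure d) ≤ C * NN h k := by
  set δ := (1 - |ht ξ|) / 2 with hδ
  have hδ0 : 0 < δ := by linarith
  have hδ1 : δ < 1 := by linarith [abs_nonneg (ht ξ)]
  obtain ⟨c, hc, hlow⟩ := lower_measure d hd δ hδ0 hδ1
  obtain ⟨c0, hc0, hlow0⟩ := gball_lower d hd (ρ := δ / 2) (by linarith)
  refine ⟨Real.pi ^ β * ((c * δ)⁻¹ + c0⁻¹), by positivity, ?_⟩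
  intro h k H hp ζ r hr hrpi hζ
  have hN := NN_nonneg h k
  have hpw : r ^ β ≤ Real.pi ^ β := Real.rpow_le_rpow hr.le hrpi hβ.le
  rw [mul_assoc]
  have hav : ⨍ η in gball ζ r, |h η| ∂(sphMeasure d) ≤ ((c * δ)⁻¹ + c0⁻¹) * NN h k := by
    rcases lt_or_ge r (δ/2) with hlt | hge
    · have key : ⨍ η in gball ζ r, |h η| ∂(sphMeasure d) ≤ NN h k / (c * δ) := by
        apply le_of_forall_gt_imp_ge_of_dense
        intro M hM
        have hM0 : 0 < M := lt_of_le_of_lt (by positivity) hM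
        have hneg : NN (fun η => - h η) (fun η => - k η) = NN h k := by simp [NN]
        have s1 := H.sup_bound hp hδ0 hδ1 hc hlow hM
        have s2 := H.neg.sup_bound (fun a b hab => by show -h a = -h b; rw [hp a b hab]) hδ0 hδ1 hc hlow
          (M := M) (by rw [hneg]; exact hM)
        apply avg_le (measurable_gball ζ r) hM0.le
        filter_upwards [s1, s2] with η h1 h2 h3
        have h4 : |ht η| ≤ 1 - δ := by
          have a1 := abs_ht_sub_le ζ η
          have a2 := chord_le ζ η
          have a3 := abs_ht_sub_le ζ ξ
          have a4 := chord_le ζ ξ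
          have a5 : geodist ζ η < r := h3
          have a6 := abs_le.1 (a1.trans a2)
          have a7 := abs_le.1 (a3.trans a4)
          have a8 := le_abs_self (ht ξ)
          have a9 := neg_abs_le (ht ξ)
          rw [abs_le]
          constructor <;> linarith
        rw [abs_le]
        constructor <;> linarith [h1 h4, h2 h4]
      have : 0 ≤ c0⁻¹ * NN h k := by positivity
      rw [div_eq_inv_mul] at key
      linarith
    · have h1 := avg_le_int H.1 hc0 (hlow0 ζ r hge)
      have h2 : ∫ η, |h η| ∂(sphMeasure d) ≤ NN h k := by
        unfold NN
        have b1 := integral_nonneg (μ := sphMeasure d) (f := fun η => |h η|) (fun _ => abs_nonneg _)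
        have b2 := integral_nonneg (μ := sphMeasure d) (f := fun η => |k η|) (fun _ => abs_nonneg _)
        have b3 : (1:ℝ) ≤ d := by exact_mod_cast hd
        nlinarith
      have h3 := mul_le_mul_of_nonneg_left h2 (inv_nonneg.2 hc0.le)
      have : 0 ≤ (c * δ)⁻¹ * NN h k := by positivity
      linarith
  have hav0 : 0 ≤ ⨍ η in gball ζ r, |h η| ∂(sphMeasure d) := by
    rw [setAverage_eq, smul_eq_mul]
    exact mul_nonneg (by positivity) (integral_nonneg fun _ => abs_nonneg _)
  exact mul_le_mul hpw hav hav0 (by positivity)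

lemma avg_sub {d : ℕ} {f h : Sph d → ℝ} (hf : Integrable f (sphMeasure d))
    (hh : Integrable h (sphMeasure d)) (s : Set (Sph d)) :
    ⨍ η in s, |f η| ∂(sphMeasure d) ≤
      ⨍ η in s, |h η| ∂(sphMeasure d) + ⨍ η in s, |f η - h η| ∂(sphMeasure d) := by
  have hs : Integrable (fun η => |f η - h η|) (sphMeasure d) := (hf.sub hh).abs
  simp only [setAverage_eq, smul_eq_mul]
  rw [← mul_add, ← integral_add hh.abs.integrableOn hs.integrableOn]
  apply mul_le_mul_of_nonneg_left _ (by positivity)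
  apply integral_mono hf.abs.integrableOn
    (hh.abs.integrableOn.add hs.integrableOn)
  intro η
  show |f η| ≤ |h η| + |f η - h η|
  have := abs_add_le (h η) (f η - h η)
  simpa using this

lemma NN_comm {d : ℕ} (f h k l : Sph d → ℝ) : NN (fun η => f η - h η) (fun η => k η - l η) =
    NN (fun η => h η - f η) (fun η => l η - k η) := by
  unfold NN
  simp only [abs_sub_comm]

lemma sphMax_le {d : ℕ} (hd : 1 ≤ d) {β : ℝ} {ξ : Sph d} {C : ℝ}
    (hC : ∀ h k : Sph d → ℝ, WId h k → IsPolar h → ∀ (ζ : Sph d) (r : ℝ), 0 < r →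
      r ≤ Real.pi → geodist ζ ξ ≤ r →
      r ^ β * ⨍ η in gball ζ r, |h η| ∂(sphMeasure d) ≤ C * NN h k)
    {f k h l : Sph d → ℝ} (Hf : WId f k) (Hh : WId h l) (hf : IsPolar f) (hh : IsPolar h) :
    sphMax β f ξ ≤ sphMax β h ξ + C * NN (fun η => f η - h η) (fun η => k η - l η) := by
  unfold sphMax
  apply csSup_le
  · refine ⟨_, ξ, Real.pi, Real.pi_pos, le_rfl, Real.arccos_le_pi _, rfl⟩
  rintro a ⟨ζ, r, h1, h2, h3, rfl⟩
  have hb : BddAbove {a | ∃ ζ : Sph d, ∃ r : ℝ, 0 < r ∧ r ≤ Real.pi ∧ geodist ζ ξ ≤ r ∧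
    a = r ^ β * ⨍ η in gball ζ r, |h η| ∂(sphMeasure d)} := by
    refine ⟨C * NN h l, ?_⟩
    rintro a ⟨ζ, r, h1, h2, h3, rfl⟩
    exact hC h l Hh hh ζ r h1 h2 h3
  have e1 := le_csSup hb ⟨ζ, r, h1, h2, h3, rfl⟩
  have e2 := hC _ _ (Hf.sub Hh) (fun a b hab => by
    show f a - h a = f b - h b; rw [hf a b hab, hh a b hab]) ζ r h1 h2 h3
  have e3 := mul_le_mul_of_nonneg_left (avg_sub Hf.1 Hh.1 (gball ζ r)) (Real.rpow_nonneg h1.le β)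
  rw [mul_add] at e3
  linarith

lemma ae_nonpole (d : ℕ) (hd : 1 ≤ d) : ∀ᵐ ξ ∂(sphMeasure d), |ht ξ| < 1 := by
  have h0 : ∀ x : Sph d, sphMeasure d {x} = 0 := by
    intro x
    rw [sphMeasure_eq]
    have : (0:ℝ) < d := by exact_mod_cast hd
    have := Measure.nullSingletonClass_hausdorff (Sph d) this
    exact measure_singleton x
  filter_upwards [measure_eq_zero_iff_ae_notMem.1 (h0 (npole d)),
    measure_eq_zero_iff_ae_notMem.1 (h0 (spole d))] with ξ h1 h2
  refine lt_of_le_of_ne (abs_ht_le ξ) fun h3 => ?_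
  have n1 : ‖(ξ : Euc (d + 1))‖ = 1 := by simp
  have n2 : ‖(npole d : Euc (d + 1))‖ = 1 := by simp
  have n3 : ‖(spole d : Euc (d + 1))‖ = 1 := by simp
  rcases (abs_eq zero_le_one).1 h3 with h | h
  · rw [← inner_npole, inner_eq_one_iff_of_norm_eq_one n1 n2] at h
    exact h1 (Subtype.ext h)
  · have : ⟪(ξ : Euc (d + 1)), (spole d : Euc (d + 1))⟫ = 1 := by
      show ⟪(ξ : Euc (d + 1)), -(npole d : Euc (d + 1))⟫ = 1
      rw [inner_neg_right, inner_npole, h]; norm_num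
    rw [inner_eq_one_iff_of_norm_eq_one n1 n3] at this
    exact h2 (Subtype.ext this)

/-- **Pointwise convergence of maximal functions.** If `f_j → f` in `W^{1,1}_pol(𝕊^d)` and
`0 < β < d`, then `𝓜̃_β f_j(ξ) → 𝓜̃_β f(ξ)` for a.e. `ξ ∈ 𝕊^d`. -/
theorem pointwise_maximal_convergence (d : ℕ) (hd : 1 ≤ d) (β : ℝ)
    (hβ0 : 0 < β) (hβd : β < d)
    (f : Sph d → ℝ) (g : Sph d → Euc (d + 1))
    (fj : ℕ → Sph d → ℝ) (gj : ℕ → Sph d → Euc (d + 1))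
    (hf : MemW11 f g) (hfpol : IsPolar f)
    (hfj : ∀ j, MemW11 (fj j) (gj j)) (hfjpol : ∀ j, IsPolar (fj j))
    (hconv : W11Tendsto fj gj f g) :
    ∀ᵐ ξ ∂(sphMeasure d),
      Tendsto (fun j => sphMax β (fj j) ξ) atTop (nhds (sphMax β f ξ)) := by
  filter_upwards [ae_nonpole d hd] with ξ hξ
  obtain ⟨C, hC0, hC⟩ := elem_bound hd hβ0 hξ
  set D : ℕ → ℝ := fun j => NN (fun η => fj j η - f η) (fun η => gj j η 0 - g η 0) with hD
  have hd1 : (1:ℝ) ≤ d := by exact_mod_cast hd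
  have hDlim : Tendsto D atTop (nhds 0) := by
    have h1 : Tendsto (fun j => (d:ℝ) * ((∫ ξ, |fj j ξ - f ξ| ∂(sphMeasure d)) +
        ∫ ξ, ‖gj j ξ - g ξ‖ ∂(sphMeasure d))) atTop (nhds 0) := by
      simpa using hconv.const_mul (d : ℝ)
    refine squeeze_zero (fun j => NN_nonneg _ _) (fun j => ?_) h1
    have h2 : ∫ η, |gj j η 0 - g η 0| ∂(sphMeasure d) ≤ ∫ ξ, ‖gj j ξ - g ξ‖ ∂(sphMeasure d) := by
      apply integral_mono (((hfj j).wid.2.1).sub hf.wid.2.1).abs ((hfj j).2.1.sub hf.2.1).norm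
      intro η
      have := PiLp.norm_apply_le (gj j η - g η) 0
      simpa using this
    have h3 : 0 ≤ ∫ ξ, ‖gj j ξ - g ξ‖ ∂(sphMeasure d) := integral_nonneg fun _ => norm_nonneg _
    simp only [hD, NN]
    nlinarith
  rw [tendsto_iff_dist_tendsto_zero]
  have hlim : Tendsto (fun j => C * D j) atTop (nhds 0) := by
    simpa using hDlim.const_mul C
  refine squeeze_zero (fun j => dist_nonneg) (fun j => ?_) hlim
  rw [Real.dist_eq, abs_le]
  have u1 := sphMax_le hd hC (hfj j).wid hf.wid (hfjpol j) hfpol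
  have u2 := sphMax_le hd hC hf.wid (hfj j).wid hfpol (hfjpol j)
  rw [NN_comm] at u2
  constructor <;> linarith

end
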